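/- Let Ω be a measurable space, let A₁, …, A_k be pairwise disjoint measurable sets covering Ω, let p₁, …, p_k and q₁, …, q_k be probability measures on Ω with pᵢ(Aᵢ) = 1 and qᵢ(Aᵢ) = 1 for every i, and let π₁, …, π_k ≥ 0 with Σᵢ πᵢ = 1. Define the mixtures P = Σᵢ πᵢ pᵢ and Q = Σᵢ πᵢ qᵢ. Then JSD(P‖Q) = Σᵢ πᵢ · JSD(pᵢ‖qᵢ). -/

import Mathlib

open MeasureTheory
open scoped ENNReal

/-- The Kullback–Leibler divergence `KL(P‖Q) = ∫ log (dP/dQ) dP`, equal to `+∞` if `P` is not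
absolutely continuous with respect to `Q` (or if the log-likelihood ratio is not integrable). -/
noncomputable def klDiv {Ω : Type*} [MeasurableSpace Ω] (P Q : Measure Ω) : EReal :=
  open scoped Classical in
  if P ≪ Q ∧ Integrable (llr P Q) P then ((∫ x, llr P Q x ∂P : ℝ) : EReal) else ⊤

/-- The Jensen–Shannon divergence `JSD(P‖Q) = (1/2) KL(P‖M) + (1/2) KL(Q‖M)`,
where `M = (P + Q)/2`. -/
noncomputable def jsDiv {Ω : Type*} [MeasurableSpace Ω] (P Q : Measure Ω) : EReal :=
  (((1 : ℝ) / 2 : ℝ) : EReal) * klDiv P ((2 : ℝ≥0∞)⁻¹ • (P + Q))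
    + (((1 : ℝ) / 2 : ℝ) : EReal) * klDiv Q ((2 : ℝ≥0∞)⁻¹ • (P + Q))

section Helpers

variable {Ω : Type*} [MeasurableSpace Ω]

lemma rnDeriv_le_const_of_le_smul {P M : Measure Ω} [IsFiniteMeasure P] [IsFiniteMeasure M]
    {c : ℝ≥0∞} (h : P ≤ c • M) : ∀ᵐ x ∂M, P.rnDeriv M x ≤ c := by
  refine ae_le_of_forall_setLIntegral_le_of_sigmaFinite (Measure.measurable_rnDeriv P M)
    (g := fun _ ↦ c) fun s _ _ ↦ ?_
  calc ∫⁻ x in s, P.rnDeriv M x ∂M ≤ P s := Measure.setLIntegral_rnDeriv_le s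
    _ ≤ c * M s := by simpa using h s
    _ = ∫⁻ _ in s, c ∂M := by simp

lemma integrable_llr_of_le_smul {P M : Measure Ω} [IsFiniteMeasure P] [IsFiniteMeasure M]
    {c : ℝ≥0∞} (hc : c ≠ ∞) (h : P ≤ c • M) : Integrable (llr P M) P := by
  have hac : P ≪ M := Measure.absolutelyContinuous_of_le_smul h
  rw [← integrable_rnDeriv_mul_log_iff hac]
  obtain ⟨C, hC⟩ := isCompact_Icc.exists_bound_of_continuousOn
    (s := Set.Icc 0 c.toReal) Real.continuous_mul_log.continuousOn
  refine Integrable.of_bound (by fun_prop) C ?_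
  filter_upwards [rnDeriv_le_const_of_le_smul h] with x hx
  exact hC _ ⟨ENNReal.toReal_nonneg, ENNReal.toReal_mono hc hx⟩

lemma klDiv_eq_coe_integral_of_le_smul {P M : Measure Ω} [IsFiniteMeasure P] [IsFiniteMeasure M]
    {c : ℝ≥0∞} (hc : c ≠ ∞) (h : P ≤ c • M) :
    klDiv P M = ((∫ x, llr P M x ∂P : ℝ) : EReal) :=
  if_pos ⟨Measure.absolutelyContinuous_of_le_smul h, integrable_llr_of_le_smul hc h⟩

lemma left_le_two_smul_midpoint (P Q : Measure Ω) :
    P ≤ (2 : ℝ≥0∞) • ((2 : ℝ≥0∞)⁻¹ • (P + Q)) := by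
  rw [smul_smul, ENNReal.mul_inv_cancel two_ne_zero ENNReal.ofNat_ne_top, one_smul]
  exact Measure.le_add_right le_rfl

lemma right_le_two_smul_midpoint (P Q : Measure Ω) :
    Q ≤ (2 : ℝ≥0∞) • ((2 : ℝ≥0∞)⁻¹ • (P + Q)) :=
  add_comm Q P ▸ left_le_two_smul_midpoint Q P

lemma llr_restrict_ae_eq {P M : Measure Ω} [IsFiniteMeasure P] [IsFiniteMeasure M] (h : P ≪ M)
    {s : Set Ω} (hs : MeasurableSet s) :
    llr (P.restrict s) (M.restrict s) =ᵐ[P.restrict s] llr P M := by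
  have hrn : (P.restrict s).rnDeriv (M.restrict s) =ᵐ[M.restrict s] P.rnDeriv M := by
    conv_lhs => rw [← Measure.withDensity_rnDeriv_eq P M h, restrict_withDensity hs]
    exact Measure.rnDeriv_withDensity _ (Measure.measurable_rnDeriv P M)
  filter_upwards [(h.restrict s).ae_le hrn] with x hx
  simp [llr, hx]

lemma restrict_sum_smul_of_disjoint {ι : Type*} [Fintype ι] {A : ι → Set Ω}
    (hdisj : Pairwise (Function.onFun Disjoint A)) {p : ι → Measure Ω}
    (hp : ∀ i, ∀ᵐ x ∂p i, x ∈ A i) (c : ι → ℝ≥0∞) (i : ι) :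
    (∑ j, c j • p j).restrict (A i) = c i • p i := by
  ext s hs
  rw [Measure.restrict_apply hs, Measure.finsetSum_apply, Finset.sum_eq_single i]
  · rw [← Measure.restrict_apply hs, Measure.restrict_smul,
      Measure.restrict_eq_self_of_ae_mem (hp i)]
  · intro j _ hj
    have : p j (s ∩ A i) = 0 := measure_mono_null
      (fun x hx hxj ↦ (hdisj hj).le_bot ⟨hxj, hx.2⟩) (hp j)
    simp [this]
  · simp

/-- Integrating the log-likelihood ratio of two mixtures whose components are carried by the same
disjoint sets amounts to mixing the componentwise integrals. -/
lemma integral_llr_sum_smul_of_disjoint {ι : Type*} [Fintype ι] {A : ι → Set Ω}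
    (hA : ∀ i, MeasurableSet (A i)) (hdisj : Pairwise (Function.onFun Disjoint A))
    {p m : ι → Measure Ω} [∀ i, IsFiniteMeasure (p i)] [∀ i, IsFiniteMeasure (m i)]
    (hp : ∀ i, ∀ᵐ x ∂p i, x ∈ A i) (hm : ∀ i, ∀ᵐ x ∂m i, x ∈ A i) (hpm : ∀ i, p i ≪ m i)
    {c : ι → ℝ≥0∞} (hc : ∀ i, c i ≠ ∞)
    {P M : Measure Ω} [IsFiniteMeasure P] [IsFiniteMeasure M]
    (hP : P = ∑ i, c i • p i) (hM : M = ∑ i, c i • m i) (hac : P ≪ M)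
    (hint : Integrable (llr P M) P) :
    ∫ x, llr P M x ∂P = ∑ i, (c i).toReal * ∫ x, llr (p i) (m i) x ∂p i := by
  have hint' : ∀ i ∈ Finset.univ, Integrable (llr P M) (c i • p i) := by
    rw [← integrable_finsetSum_measure, ← hP]
    exact hint
  have hsum : ∫ x, llr P M x ∂P = ∑ i, ∫ x, llr P M x ∂(c i • p i) := by
    rw [← integral_finsetSum_measure hint', ← hP]
  rw [hsum]
  refine Finset.sum_congr rfl fun i _ ↦ ?_
  rw [integral_smul_measure, smul_eq_mul]
  rcases eq_or_ne (c i) 0 with h0 | h0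
  · simp [h0]
  congr 1
  refine integral_congr_ae ?_
  have hres := llr_restrict_ae_eq hac (hA i)
  have hPi : P.restrict (A i) = c i • p i := hP ▸ restrict_sum_smul_of_disjoint hdisj hp c i
  have hMi : M.restrict (A i) = c i • m i := hM ▸ restrict_sum_smul_of_disjoint hdisj hm c i
  rw [hPi, hMi] at hres
  filter_upwards [(Measure.absolutelyContinuous_smul h0).ae_le hres,
    llr_smul_same (hpm i) (c i) h0 (hc i)] with x hx hx'
  rw [← hx, hx']

lemma EReal.coe_finsetSum {ι : Type*} (s : Finset ι) (f : ι → ℝ) :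
    ((∑ i ∈ s, f i : ℝ) : EReal) = ∑ i ∈ s, (f i : EReal) :=
  map_sum (⟨⟨Real.toEReal, EReal.coe_zero⟩, EReal.coe_add⟩ : ℝ →+ EReal) f s

lemma jsDiv_eq_coe (P Q : Measure Ω) [IsFiniteMeasure P] [IsFiniteMeasure Q]
    [IsFiniteMeasure ((2 : ℝ≥0∞)⁻¹ • (P + Q))] :
    jsDiv P Q = ((1 / 2 * ∫ x, llr P ((2 : ℝ≥0∞)⁻¹ • (P + Q)) x ∂P
      + 1 / 2 * ∫ x, llr Q ((2 : ℝ≥0∞)⁻¹ • (P + Q)) x ∂Q : ℝ) : EReal) := by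
  rw [jsDiv,
    klDiv_eq_coe_integral_of_le_smul ENNReal.ofNat_ne_top (left_le_two_smul_midpoint P Q),
    klDiv_eq_coe_integral_of_le_smul ENNReal.ofNat_ne_top (right_le_two_smul_midpoint P Q),
    EReal.coe_add, EReal.coe_mul, EReal.coe_mul]

end Helpers

theorem jsd_of_mixtures_eq_mixture_of_jsds
    {Ω : Type*} [MeasurableSpace Ω] (k : ℕ) (hk : 1 ≤ k)
    (A : Fin k → Set Ω) (hAmeas : ∀ i, MeasurableSet (A i))
    (hAdisj : Pairwise (Function.onFun Disjoint A))
    (hAcover : ⋃ i, A i = Set.univ)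
    (p q : Fin k → Measure Ω)
    [∀ i, IsProbabilityMeasure (p i)] [∀ i, IsProbabilityMeasure (q i)]
    (hp : ∀ i, p i (A i) = 1) (hq : ∀ i, q i (A i) = 1)
    (π : Fin k → ℝ) (hπ : ∀ i, 0 ≤ π i) (hπsum : ∑ i, π i = 1)
    (P Q : Measure Ω)
    (hP : P = ∑ i : Fin k, ENNReal.ofReal (π i) • p i)
    (hQ : Q = ∑ i : Fin k, ENNReal.ofReal (π i) • q i) :
    jsDiv P Q = ∑ i : Fin k, (π i : EReal) * jsDiv (p i) (q i) := by
  have hfin : ∀ (μ ν : Measure Ω) [IsFiniteMeasure μ] [IsFiniteMeasure ν],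
      IsFiniteMeasure ((2 : ℝ≥0∞)⁻¹ • (μ + ν)) := fun μ ν _ _ ↦
    Measure.smul_finite _ (ENNReal.inv_ne_top.2 two_ne_zero)
  have hc : ∀ i, ENNReal.ofReal (π i) ≠ ∞ := fun _ ↦ ENNReal.ofReal_ne_top
  have hmix : ∀ r : Fin k → Measure Ω, (∀ i, IsProbabilityMeasure (r i)) →
      IsFiniteMeasure (∑ i, ENNReal.ofReal (π i) • r i) := fun r _ ↦ by
    refine ⟨?_⟩
    simp [Measure.finsetSum_apply]
  have : IsFiniteMeasure P := hP ▸ hmix p inferInstance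
  have : IsFiniteMeasure Q := hQ ▸ hmix q inferInstance
  have hpA : ∀ i, ∀ᵐ x ∂p i, x ∈ A i := fun i ↦ (prob_compl_eq_zero_iff (hAmeas i)).2 (hp i)
  have hqA : ∀ i, ∀ᵐ x ∂q i, x ∈ A i := fun i ↦ (prob_compl_eq_zero_iff (hAmeas i)).2 (hq i)
  have hmA : ∀ i, ∀ᵐ x ∂((2 : ℝ≥0∞)⁻¹ • (p i + q i)), x ∈ A i := fun i ↦
    Measure.ae_smul_measure (ae_add_measure_iff.2 ⟨hpA i, hqA i⟩) _
  have hM : (2 : ℝ≥0∞)⁻¹ • (P + Q)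
      = ∑ i, ENNReal.ofReal (π i) • ((2 : ℝ≥0∞)⁻¹ • (p i + q i)) := by
    rw [hP, hQ, ← Finset.sum_add_distrib, Finset.smul_sum]
    exact Finset.sum_congr rfl fun i _ ↦ by rw [← smul_add, smul_comm]
  have hPint := integral_llr_sum_smul_of_disjoint hAmeas hAdisj hpA hmA
    (fun i ↦ Measure.absolutelyContinuous_of_le_smul (left_le_two_smul_midpoint (p i) (q i)))
    hc hP hM
    (Measure.absolutelyContinuous_of_le_smul (left_le_two_smul_midpoint P Q))
    (integrable_llr_of_le_smul ENNReal.ofNat_ne_top (left_le_two_smul_midpoint P Q))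
  have hQint := integral_llr_sum_smul_of_disjoint hAmeas hAdisj hqA hmA
    (fun i ↦ Measure.absolutelyContinuous_of_le_smul (right_le_two_smul_midpoint (p i) (q i)))
    hc hQ hM
    (Measure.absolutelyContinuous_of_le_smul (right_le_two_smul_midpoint P Q))
    (integrable_llr_of_le_smul ENNReal.ofNat_ne_top (right_le_two_smul_midpoint P Q))
  simp_rw [jsDiv_eq_coe, hPint, hQint, ← EReal.coe_mul, ← EReal.coe_finsetSum,
    ENNReal.toReal_ofReal (hπ _), Finset.mul_sum, ← Finset.sum_add_distrib]
  congr 1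
  exact Finset.sum_congr rfl fun i _ ↦ by ring
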